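/- There exists N such that the following holds for all n ≥ N. Let G be an (r_G/n)-pseudorandom graph on n vertices with r_G ≥ 2(log n)², and let H be a spanning subgraph of G with δ(H) ≥ (1 − 1/1100)·r_G. Let H' be an arbitrary r_{H'}-regular graph on the same vertex set, edge-disjoint from H, and let E_bad ⊆ E(H'). Suppose r_{H'} + 1 + 10⁶·|E_bad|/n ≤ r_G/5000. Then there exist m ≤ r_G/5000 and pairwise edge-disjoint 2-factors F₁,…,F_{2m} of H ∪ H' whose union contains every edge of H', such that each Fᵢ has at most 4n√(log n)/√(r_G) cycles and each set E(Fᵢ) ∩ E_bad is a matching of size at most n/10⁶. -/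

import Mathlib

open scoped Classical
open SimpleGraph

namespace EDHC

/-- Degree of a vertex (as cardinality of its neighbour set). -/
noncomputable def deg {V : Type} (G : SimpleGraph V) (v : V) : ℕ := (G.neighborSet v).ncard

/-- Minimum degree. -/
noncomputable def minDeg {V : Type} (G : SimpleGraph V) : ℕ := sInf (Set.range (deg G))

/-- Maximum degree. -/
noncomputable def maxDeg {V : Type} (G : SimpleGraph V) : ℕ := sSup (Set.range (deg G))

/-- Number of edges of `G` with both endpoints in `S`. -/
noncomputable def eIn {V : Type} (G : SimpleGraph V) (S : Set V) : ℕ :=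
  {e ∈ G.edgeSet | ∀ v ∈ e, v ∈ S}.ncard

/-- Number of edges of `G` with one endpoint in `S` and the other in `T`. -/
noncomputable def eBtw {V : Type} (G : SimpleGraph V) (S T : Set V) : ℕ :=
  {e ∈ G.edgeSet | ∃ a ∈ S, ∃ b ∈ T, e = s(a, b)}.ncard

/-- `G` is `(p, β)`-jumbled. -/
def IsJumbled {V : Type} (G : SimpleGraph V) (p β : ℝ) : Prop :=
  ∀ S : Set V, |(eIn G S : ℝ) - p * ((S.ncard : ℝ) * ((S.ncard : ℝ) - 1) / 2)| ≤ β * S.ncard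

/-- `G` is strongly `2`-jumping. -/
def StronglyTwoJumping (n : ℕ) (G : SimpleGraph (Fin n)) : Prop :=
  ∀ T : Set (Fin n), T.Nonempty →
    (∑ v ∈ (Set.toFinite T).toFinset, (deg G v : ℝ)) / (T.ncard : ℝ) ≥
      (minDeg G : ℝ) + min ((T.ncard : ℝ) - 1) ((Real.log n) ^ 2)

/-- `G` is `p`-pseudorandom. -/
def IsPseudorandom (n : ℕ) (G : SimpleGraph (Fin n)) (p : ℝ) : Prop :=
  IsJumbled G p (2 * Real.sqrt (n * p * (1 - p))) ∧
  (∀ S T : Set (Fin n), Disjoint S T →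
    ((1 / (S.ncard : ℝ) + 1 / (T.ncard : ℝ)) * Real.log n / p ≥ 7 / 2 →
      (eBtw G S T : ℝ) ≤ 2 * ((S.ncard : ℝ) + (T.ncard : ℝ)) * Real.log n) ∧
    ((1 / (S.ncard : ℝ) + 1 / (T.ncard : ℝ)) * Real.log n / p ≤ 7 / 2 →
      (eBtw G S T : ℝ) ≤ 7 * (S.ncard : ℝ) * (T.ncard : ℝ) * p)) ∧
  (∀ S : Set (Fin n),
    (Real.log n / ((S.ncard : ℝ) * p) ≥ 7 / 4 → (eIn G S : ℝ) ≤ 2 * (S.ncard : ℝ) * Real.log n) ∧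
    (Real.log n / ((S.ncard : ℝ) * p) ≤ 7 / 4 → (eIn G S : ℝ) ≤ 7 * (S.ncard : ℝ) ^ 2 * p / 2)) ∧
  ((n : ℝ) * p - 2 * Real.sqrt ((n : ℝ) * p * Real.log n) ≤ (minDeg G : ℝ) ∧
    (minDeg G : ℝ) ≤ (n : ℝ) * p - 200 * Real.sqrt ((n : ℝ) * p * (1 - p)) ∧
    (maxDeg G : ℝ) ≤ (n : ℝ) * p + 2 * Real.sqrt ((n : ℝ) * p * Real.log n)) ∧
  StronglyTwoJumping n G

/-- `G` is `u`-jumping. -/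
def IsJumping (n : ℕ) (G : SimpleGraph (Fin n)) (u : ℝ) : Prop :=
  ∃ x₀ : Fin n, deg G x₀ = minDeg G ∧
    ∀ x : Fin n, x ≠ x₀ → (deg G x : ℝ) ≥ (minDeg G : ℝ) + u

/-- `C` is a Hamilton cycle (on the whole vertex set `Fin n`). -/
def IsHamCycle {n : ℕ} (C : SimpleGraph (Fin n)) : Prop :=
  ∃ (v : Fin n) (w : C.Walk v v), w.IsHamiltonianCycle ∧ C.edgeSet = {e | e ∈ w.edges}

/-- `G` has property `H`. -/
def HasPropertyH (n : ℕ) (G : SimpleGraph (Fin n)) : Prop :=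
  ∃ HC : Fin (minDeg G / 2) → SimpleGraph (Fin n),
    (∀ i, HC i ≤ G ∧ IsHamCycle (HC i)) ∧
    (∀ i j, i ≠ j → Disjoint (HC i).edgeSet (HC j).edgeSet) ∧
    (Odd (minDeg G) →
      ∃ M : SimpleGraph (Fin n), M ≤ G ∧ (∀ v, deg M v ≤ 1) ∧
        M.edgeSet.ncard = n / 2 ∧ ∀ i, Disjoint M.edgeSet (HC i).edgeSet)

/-- Probability of the event `A` under the binomial random graph `G_{n,p}`. -/
noncomputable def gnpProb (n : ℕ) (p : ℝ) (A : SimpleGraph (Fin n) → Prop) : ℝ :=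
  ∑ G : SimpleGraph (Fin n),
    if A G then p ^ G.edgeSet.ncard * (1 - p) ^ (n.choose 2 - G.edgeSet.ncard) else 0


/-- Number of cycles of a 2-regular graph = number of connected components. -/
noncomputable def numCycles {V : Type} (F : SimpleGraph V) : ℕ := Nat.card F.ConnectedComponent

/-- `N` is a perfect matching on the whole vertex set. -/
def IsPerfectMatchingGraph {n : ℕ} (N : SimpleGraph (Fin n)) : Prop :=
  ∀ v, ((N.neighborSet v).ncard) = 1

/-- `N` is a perfect pseudomatching: one vertex of degree 2, all others of degree 1. -/
def IsPerfectPseudomatching {n : ℕ} (N : SimpleGraph (Fin n)) : Prop :=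
  ∃ w, ((N.neighborSet w).ncard) = 2 ∧ ∀ v, v ≠ w → ((N.neighborSet v).ncard) = 1

/-- A set of edges forms a matching (no two distinct edges share a vertex). -/
def IsMatchingSet {n : ℕ} (E : Set (Sym2 (Fin n))) : Prop :=
  ∀ e ∈ E, ∀ f ∈ E, e ≠ f → ∀ v : Fin n, v ∈ e → v ∉ f

/-- Number of cycles (orbits, including fixed points) of a permutation. -/
noncomputable def cycleCount {α : Type} (σ : Equiv.Perm α) : ℕ :=
  Nat.card (Quotient (⟨σ.SameCycle,
    ⟨fun x => Equiv.Perm.SameCycle.refl σ x, fun h => h.symm, fun h h' => h.trans h'⟩⟩ : Setoid α))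

/-- Edges of the bipartite graph given by the relation `R` between `S` and `T`. -/
noncomputable def eBip {n : ℕ} (R : Fin n → Fin n → Prop) (S T : Set (Fin n)) : ℕ :=
  {q : Fin n × Fin n | q.1 ∈ S ∧ q.2 ∈ T ∧ R q.1 q.2}.ncard

/-- One rotation of a path (represented as a list of vertices), with new edge from `H`
and pivot in `Q`. -/
def RotStep {V : Type} (H : SimpleGraph V) (Q : Set V) (l l' : List V) : Prop :=
  ∃ (x : V) (a : List V) (p : V) (b : List V),
    l = (x :: a) ++ p :: b ∧ l' = (x :: a).reverse ++ p :: b ∧ p ∈ Q ∧ H.Adj x p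

/-- `v` is `(H, Q, τ)`-reachable from the path `l`. -/
def ReachableVert {V : Type} (H : SimpleGraph V) (Q : Set V) (τ : ℕ) (l : List V) (v : V) : Prop :=
  ∃ (k : ℕ) (f : ℕ → List V), k ≤ τ ∧ f 0 = l ∧
    (∀ i < k, RotStep H Q (f i) (f (i + 1))) ∧ (f k).head? = some v

/-- External neighbourhood. -/
def extNbhd {V : Type} (H : SimpleGraph V) (S : Set V) : Set V :=
  (⋃ x ∈ S, H.neighborSet x) \ S


end EDHC

namespace EDHC

/-- If every event is hit often enough on average, then some choice function hits
all events more than `D` times. -/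
theorem exists_choice_many_hits {E Y : Type} [Fintype E] [Fintype Y] [Nonempty Y] {k : ℕ}
    (X : E → Fin k → Y → Prop) (C D : ℝ)
    (hC : ∀ e, C ≤ ∑ g, ((Finset.univ.filter fun y => X e g y).card : ℝ))
    (h : (Fintype.card E : ℝ) * (2 : ℝ) ^ D * Real.exp (-C / (2 * Fintype.card Y)) < 1) :
    ∃ f : Fin k → Y, ∀ e, D < ((Finset.univ.filter fun g => X e g (f g)).card : ℝ) := by
  by_contra hcon
  push Not at hcon
  have hY : (0 : ℝ) < Fintype.card Y := by exact_mod_cast Fintype.card_pos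
  let w : E → Fin k → Y → ℝ := fun e g y => if X e g y then 1 / 2 else 1
  have hwpos : ∀ e g y, 0 < w e g y := by
    intro e g y
    simp only [w]
    split_ifs <;> norm_num
  have hprod : ∀ e (f : Fin k → Y), ∏ g, w e g (f g) =
      (1 / 2 : ℝ) ^ (Finset.univ.filter fun g => X e g (f g)).card := by
    intro e f
    simp [w, Finset.prod_ite]
  have hsum : ∀ e, ∑ f : Fin k → Y, ∏ g, w e g (f g) ≤
      (Fintype.card Y : ℝ) ^ k * Real.exp (-C / (2 * Fintype.card Y)) := by
    intro e
    have h1 : ∑ f : Fin k → Y, ∏ g, w e g (f g) = ∏ g, ∑ y, w e g y := by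
      rw [Finset.prod_univ_sum]
      simp
    have h2 : ∀ g, ∑ y, w e g y ≤ (Fintype.card Y : ℝ) *
        Real.exp (-((Finset.univ.filter fun y => X e g y).card : ℝ) / (2 * Fintype.card Y)) := by
      intro g
      have h3 : ∑ y, w e g y = (Fintype.card Y : ℝ) -
          ((Finset.univ.filter fun y => X e g y).card : ℝ) / 2 := by
        have : ∀ y, w e g y = 1 - (if X e g y then (1 : ℝ) else 0) / 2 := by
          intro y
          simp only [w]
          split_ifs <;> norm_num
        simp only [this, Finset.sum_sub_distrib, ← Finset.sum_div, Finset.sum_boole]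
        simp
      rw [h3]
      have h4 := Real.add_one_le_exp
        (-((Finset.univ.filter fun y => X e g y).card : ℝ) / (2 * Fintype.card Y))
      calc _ = (Fintype.card Y : ℝ) *
          (-((Finset.univ.filter fun y => X e g y).card : ℝ) / (2 * Fintype.card Y) + 1) := by
            field_simp
            ring
        _ ≤ _ := by gcongr
    rw [h1]
    calc _ ≤ ∏ g, (Fintype.card Y : ℝ) *
        Real.exp (-((Finset.univ.filter fun y => X e g y).card : ℝ) / (2 * Fintype.card Y)) :=
          Finset.prod_le_prod (fun g _ => Finset.sum_nonneg fun y _ => (hwpos e g y).le)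
            fun g _ => h2 g
      _ = (Fintype.card Y : ℝ) ^ k * Real.exp (∑ g,
          -((Finset.univ.filter fun y => X e g y).card : ℝ) / (2 * Fintype.card Y)) := by
          rw [Finset.prod_mul_distrib, Real.exp_sum]
          simp
      _ ≤ _ := by
          rw [← Finset.sum_div, Finset.sum_neg_distrib]
          gcongr
          exact hC e
  have hone : ∀ f : Fin k → Y, 1 ≤ ∑ e, (2 : ℝ) ^ D * ∏ g, w e g (f g) := by
    intro f
    obtain ⟨e, he⟩ := hcon f
    refine le_trans ?_ (Finset.single_le_sum (f := fun e => (2 : ℝ) ^ D * ∏ g, w e g (f g))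
      (fun e _ => mul_nonneg (by positivity) (Finset.prod_nonneg fun g _ => (hwpos e g _).le))
      (Finset.mem_univ e))
    simp only [hprod]
    rw [one_div, inv_pow, ← Real.rpow_natCast, ← div_eq_mul_inv, one_le_div (by positivity)]
    exact Real.rpow_le_rpow_of_exponent_le (by norm_num) he
  have htot : (Fintype.card Y : ℝ) ^ k ≤
      ∑ f : Fin k → Y, ∑ e, (2 : ℝ) ^ D * ∏ g, w e g (f g) := by
    calc (Fintype.card Y : ℝ) ^ k = ∑ f : Fin k → Y, (1 : ℝ) := by simp
      _ ≤ _ := Finset.sum_le_sum fun f _ => hone f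
  rw [Finset.sum_comm] at htot
  simp only [← Finset.mul_sum] at htot
  have hfin : ∑ e, ∑ f : Fin k → Y, ∏ g, w e g (f g) ≤ (Fintype.card E : ℝ) *
      ((Fintype.card Y : ℝ) ^ k * Real.exp (-C / (2 * Fintype.card Y))) := by
    calc _ ≤ ∑ e : E, ((Fintype.card Y : ℝ) ^ k * Real.exp (-C / (2 * Fintype.card Y))) :=
          Finset.sum_le_sum fun e _ => hsum e
      _ = _ := by simp
  have hpow : (0 : ℝ) < (Fintype.card Y : ℝ) ^ k := by positivity
  have h2D : (0 : ℝ) < (2 : ℝ) ^ D := by positivity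
  have := mul_le_mul_of_nonneg_left hfin h2D.le
  have h5 := mul_lt_mul_of_pos_left h hpow
  nlinarith

/-- Two finsets of equal size whose bipartite relation has large minimum degree and few edges
between small sets are perfectly matched. -/
theorem exists_injOn_of_min_degree {J : Type} [Fintype J] (A B : Finset J) (R : J → J → Prop)
    (q γ D : ℝ) (hq : 0 ≤ q) (hγ : 0 ≤ γ) (hcard : A.card = B.card)
    (hA : ∀ i ∈ A, D ≤ ∑ j ∈ B, if R i j then (1 : ℝ) else 0)
    (hB : ∀ j ∈ B, D ≤ ∑ i ∈ A, if R i j then (1 : ℝ) else 0)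
    (hD : q * (A.card / 2) + 2 * γ < D)
    (hST : ∀ S ⊆ A, ∀ T ⊆ B, (∑ i ∈ S, ∑ j ∈ T, if R i j then (1 : ℝ) else 0) ≤
      q * S.card * T.card + γ * (S.card + T.card)) :
    ∃ f : J → J, (∀ i ∈ A, f i ∈ B ∧ R i (f i)) ∧ Set.InjOn f A := by
  have hall : ∀ s : Finset A, s.card ≤ (s.biUnion fun i => B.filter (R i)).card := by
    intro s
    by_contra! hlt
    set S : Finset J := s.map (Function.Embedding.subtype _) with hS
    set T : Finset J := s.biUnion fun i => B.filter (R i) with hT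
    have hScard : S.card = s.card := by simp [hS]
    have hSA : S ⊆ A := by
      intro x hx
      simp only [hS, Finset.mem_map, Function.Embedding.subtype_apply] at hx
      obtain ⟨a, -, rfl⟩ := hx
      exact a.2
    have hTB : T ⊆ B := by
      intro x hx
      simp only [hT, Finset.mem_biUnion, Finset.mem_filter] at hx
      obtain ⟨a, -, h, -⟩ := hx
      exact h
    have hmem : ∀ i ∈ S, ∀ j ∈ B, R i j → j ∈ T := by
      intro i hi j hj hR
      simp only [hS, Finset.mem_map, Function.Embedding.subtype_apply] at hi
      obtain ⟨a, ha, rfl⟩ := hi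
      simp only [hT, Finset.mem_biUnion, Finset.mem_filter]
      exact ⟨a, ha, hj, hR⟩
    have hlt' : T.card < S.card := by omega
    have hltR : (T.card : ℝ) + 1 ≤ S.card := by exact_mod_cast hlt'
    have hTc : (0 : ℝ) ≤ T.card := by positivity
    rcases le_or_gt (T.card : ℝ) (A.card / 2) with hc | hc
    · have h1 : D * S.card ≤ ∑ i ∈ S, ∑ j ∈ T, if R i j then (1 : ℝ) else 0 := by
        calc D * S.card = ∑ i ∈ S, D := by simp [mul_comm]
          _ ≤ _ := Finset.sum_le_sum fun i hi => by
            refine (hA i (hSA hi)).trans (le_of_eq ?_)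
            symm
            refine Finset.sum_subset hTB fun j hj hjT => ?_
            rw [if_neg fun hR => hjT (hmem i hi j hj hR)]
      have h2 := hST S hSA T hTB
      have h3 : q * S.card * T.card ≤ q * S.card * (A.card / 2) := by gcongr
      have h4 : γ * (S.card + T.card) ≤ γ * (2 * S.card) := by
        gcongr
        linarith
      have h5 : (0 : ℝ) < S.card := by linarith
      nlinarith
    · set S' := A \ S
      set T' := B \ T
      have hS'c : (S'.card : ℝ) = A.card - S.card := by
        rw [Finset.card_sdiff_of_subset hSA, Nat.cast_sub (Finset.card_le_card hSA)]
      have hT'c : (T'.card : ℝ) = A.card - T.card := by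
        rw [Finset.card_sdiff_of_subset hTB, Nat.cast_sub (Finset.card_le_card hTB), hcard]
      have h1 : D * T'.card ≤ ∑ i ∈ S', ∑ j ∈ T', if R i j then (1 : ℝ) else 0 := by
        rw [Finset.sum_comm]
        calc D * T'.card = ∑ i ∈ T', D := by simp [mul_comm]
          _ ≤ _ := Finset.sum_le_sum fun j hj => by
            have hj' := Finset.mem_sdiff.1 hj
            refine (hB j hj'.1).trans (le_of_eq ?_)
            symm
            refine Finset.sum_subset Finset.sdiff_subset fun i hi hiS => ?_
            have hiS' : i ∈ S := by
              by_contra h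
              exact hiS (Finset.mem_sdiff.2 ⟨hi, h⟩)
            rw [if_neg fun hR => hj'.2 (hmem i hiS' j hj'.1 hR)]
      have h2 := hST S' Finset.sdiff_subset T' Finset.sdiff_subset
      have hS'0 : (0 : ℝ) ≤ S'.card := by positivity
      have h5 : (0 : ℝ) < T'.card := by linarith
      have h3 : q * S'.card * T'.card ≤ q * (A.card / 2) * T'.card := by
        gcongr
        linarith
      have h4 : γ * (S'.card + T'.card) ≤ γ * (2 * T'.card) := by
        gcongr
        linarith
      nlinarith
  obtain ⟨f, hf, hfm⟩ :=
    (Finset.all_card_le_biUnion_card_iff_exists_injective fun i : A => B.filter (R i)).1 hall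
  refine ⟨fun i => if h : i ∈ A then f ⟨i, h⟩ else i, fun i hi => ?_, fun i hi j hj hij => ?_⟩
  · have := hfm ⟨i, hi⟩
    simp only [Finset.mem_filter] at this
    simpa [hi] using this
  · have hi' : i ∈ A := hi
    have hj' : j ∈ A := hj
    simp only [hi', hj', dif_pos] at hij
    simpa using hf hij

/-- Perfect matchings between corresponding fibres of `src` and `tgt` glue to a permutation. -/
theorem exists_perm_of_fibres {J ι : Type} [Fintype J] (src tgt : J → ι) (R : J → J → Prop)
    (q γ D K : ℝ) (hq : 0 ≤ q) (hγ : 0 ≤ γ)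
    (hcard : ∀ c, (Finset.univ.filter fun j => src j = c).card =
      (Finset.univ.filter fun j => tgt j = c).card)
    (hK : ∀ c, ((Finset.univ.filter fun j => src j = c).card : ℝ) ≤ K)
    (hR : ∀ i j, R i j → tgt j = src i)
    (hout : ∀ i, D ≤ ∑ j, if R i j then (1 : ℝ) else 0)
    (hin : ∀ j, D ≤ ∑ i, if R i j then (1 : ℝ) else 0)
    (hD : q * (K / 2) + 2 * γ < D)
    (hST : ∀ S T : Finset J, (∑ i ∈ S, ∑ j ∈ T, if R i j then (1 : ℝ) else 0) ≤
      q * S.card * T.card + γ * (S.card + T.card)) :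
    ∃ σ : Equiv.Perm J, ∀ i, R i (σ i) := by
  have key : ∀ c, ∃ f : J → J, (∀ i, src i = c → tgt (f i) = c ∧ R i (f i)) ∧
      ∀ i j, src i = c → src j = c → f i = f j → i = j := by
    intro c
    obtain ⟨f, hf, hfi⟩ := exists_injOn_of_min_degree (Finset.univ.filter fun j => src j = c)
      (Finset.univ.filter fun j => tgt j = c) R q γ D hq hγ (hcard c)
      (fun i hi => by
        refine (hout i).trans (le_of_eq ?_)
        symm
        refine Finset.sum_subset (Finset.subset_univ _) fun j _ hj => ?_
        rw [if_neg fun h => hj ?_]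
        simp only [Finset.mem_filter, Finset.mem_univ, true_and] at hi ⊢
        rw [hR i j h, hi])
      (fun j hj => by
        refine (hin j).trans (le_of_eq ?_)
        symm
        refine Finset.sum_subset (Finset.subset_univ _) fun i _ hi => ?_
        rw [if_neg fun h => hi ?_]
        simp only [Finset.mem_filter, Finset.mem_univ, true_and] at hj ⊢
        rw [← hR i j h, hj])
      (lt_of_le_of_lt (by have := hK c; gcongr) hD) (fun S _ T _ => hST S T)
    refine ⟨f, fun i hi => ?_, fun i j hi hj hij => hfi (by simpa using hi) (by simpa using hj) hij⟩
    simpa using hf i (by simpa using hi)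
  choose f hf hfi using key
  have hinj : Function.Injective fun i => f (src i) i := by
    intro i j hij
    have h1 := (hf (src i) i rfl).1
    have h2 := (hf (src j) j rfl).1
    simp only at hij
    have h3 : src i = src j := by rw [← h1, ← h2, hij]
    refine hfi (src i) i j rfl h3.symm ?_
    rw [hij, h3]
  exact ⟨Equiv.ofBijective _ (Finite.injective_iff_bijective.1 hinj),
    fun i => (hf (src i) i rfl).2⟩

theorem sum_adj_eq_two_mul_eIn {V : Type} [Fintype V] (G : SimpleGraph V) (S : Finset V) :
    (∑ u ∈ S, ∑ v ∈ S, if G.Adj u v then (1 : ℝ) else 0) = 2 * (eIn G (S : Set V) : ℝ) := by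
  let K : SimpleGraph V :=
    { Adj := fun u v => G.Adj u v ∧ u ∈ S ∧ v ∈ S
      symm := ⟨fun u v h => ⟨h.1.symm, h.2.2, h.2.1⟩⟩
      loopless := ⟨fun u h => G.loopless.irrefl u h.1⟩ }
  have hK : eIn G (S : Set V) = K.edgeFinset.card := by
    rw [eIn, ← Set.ncard_coe_finset]
    congr 1
    ext e
    induction e with
    | _ x y => simp [K]
  have h := K.sum_degrees_eq_twice_card_edges
  rw [hK]
  have hdeg : ∀ u, (K.degree u : ℝ) =
      if u ∈ S then ∑ v ∈ S, if G.Adj u v then (1 : ℝ) else 0 else 0 := by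
    intro u
    rw [← K.card_neighborFinset_eq_degree]
    split_ifs with hu
    · rw [Finset.sum_boole]
      congr 2
      ext v
      simp [K, hu, and_comm]
    · rw [Nat.cast_eq_zero, Finset.card_eq_zero]
      ext v
      simp [K, hu]
  have h' : (∑ u, (K.degree u : ℝ)) = 2 * (K.edgeFinset.card : ℝ) := by exact_mod_cast h
  rw [← h']
  simp only [hdeg]
  simp

/-- In a jumbled graph the number of ordered adjacent pairs between two vertex sets is at most
the expected number plus a linear error. -/
theorem sum_adj_le_of_isJumbled {V : Type} [Fintype V] (G : SimpleGraph V) (p β : ℝ)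
    (hp : 0 ≤ p) (hβ : 0 ≤ β) (hG : IsJumbled G p β) (S T : Finset V) :
    (∑ u ∈ S, ∑ v ∈ T, if G.Adj u v then (1 : ℝ) else 0) ≤
      p * S.card * T.card + 2 * β * (S.card + T.card) := by
  set E : Finset V → Finset V → ℝ := fun S T =>
    ∑ u ∈ S, ∑ v ∈ T, if G.Adj u v then (1 : ℝ) else 0 with hE
  have hEind : ∀ S T : Finset V, E S T = ∑ u, ∑ v, (if u ∈ S then (1 : ℝ) else 0) *
      (if v ∈ T then 1 else 0) * (if G.Adj u v then 1 else 0) := by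
    intro S T
    simp only [hE, mul_assoc, ← Finset.mul_sum]
    simp only [ite_mul, one_mul, zero_mul, Finset.sum_ite_mem, Finset.univ_inter]
  have hsymm : E S T = E T S := by
    simp only [hE]
    rw [Finset.sum_comm]
    simp only [G.adj_comm]
  have hpol : E S T + E T S + E (S \ T) (S \ T) + E (T \ S) (T \ S) =
      E (S ∪ T) (S ∪ T) + E (S ∩ T) (S ∩ T) := by
    simp only [hEind, ← Finset.sum_add_distrib]
    refine Finset.sum_congr rfl fun u _ => Finset.sum_congr rfl fun v _ => ?_
    by_cases h1 : u ∈ S <;> by_cases h2 : u ∈ T <;> by_cases h3 : v ∈ S <;>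
      by_cases h4 : v ∈ T <;> simp [h1, h2, h3, h4]
  have hj : ∀ Z : Finset V, |E Z Z - p * (Z.card * (Z.card - 1))| ≤ 2 * β * Z.card := by
    intro Z
    have h := hG (Z : Set V)
    rw [Set.ncard_coe_finset] at h
    simp only [hE]
    rw [sum_adj_eq_two_mul_eIn]
    rw [abs_le] at h ⊢
    constructor <;> nlinarith
  have hS : ((S \ T).card : ℝ) + (S ∩ T).card = S.card := by
    exact_mod_cast Finset.card_sdiff_add_card_inter S T
  have hT : ((T \ S).card : ℝ) + (S ∩ T).card = T.card := by
    rw [Finset.inter_comm]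
    exact_mod_cast Finset.card_sdiff_add_card_inter T S
  have hU : ((S ∪ T).card : ℝ) + (S ∩ T).card = S.card + T.card := by
    exact_mod_cast Finset.card_union_add_card_inter S T
  have h1 := (abs_le.1 (hj (S ∪ T))).2
  have h2 := (abs_le.1 (hj (S ∩ T))).2
  have h3 := (abs_le.1 (hj (S \ T))).1
  have h4 := (abs_le.1 (hj (T \ S))).1
  set x : ℝ := ((S \ T).card : ℝ)
  set y : ℝ := ((T \ S).card : ℝ)
  have hi : (0 : ℝ) ≤ ((S ∩ T).card : ℝ) := by positivity
  set i : ℝ := ((S ∩ T).card : ℝ)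
  have hu : ((S ∪ T).card : ℝ) = x + y + i := by linarith
  rw [hu] at h1
  rw [← hS, ← hT]
  change E S T ≤ _
  have hpi := mul_nonneg hp hi
  have hbi := mul_nonneg hβ hi
  nlinarith

/-- Paths (here of at most two vertices) linked up by a permutation of the paths form a
2-factor. -/
theorem exists_twoFactor_of_perm {V J : Type} [Fintype V] (H M : SimpleGraph V) (a b : J → V)
    (σ : Equiv.Perm J) (ha : Function.Injective a) (hb : Function.Injective b)
    (hab : ∀ i j, a i = b j → i = j) (hsurj : ∀ v, ∃ j, v = a j ∨ v = b j)
    (hM : ∀ v w, M.Adj v w → ∃ j, (v = a j ∧ w = b j) ∨ (v = b j ∧ w = a j))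
    (hMH : ∀ j, a j ≠ b j → (H ⊔ M).Adj (a j) (b j))
    (hlink : ∀ j, H.Adj (b j) (a (σ j))) (hσ : ∀ j, σ (σ j) ≠ j) (J₀ : Finset J)
    (hJ₀ : ∀ j, ∃ m : ℕ, (σ ^ m) j ∈ J₀) :
    ∃ F : SimpleGraph V, M ≤ F ∧ F ≤ H ⊔ M ∧ (∀ v, deg F v = 2) ∧ numCycles F ≤ J₀.card := by
  have hσ1 : ∀ j, σ j ≠ j := fun j h => hσ j (by rw [h, h])
  have hσ2 : ∀ j, σ.symm j ≠ j := fun j h => hσ1 j (by rw [Equiv.symm_apply_eq] at h; exact h.symm)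
  have hσ3 : ∀ j, σ.symm j ≠ σ j := fun j h => hσ j (by rw [← h]; simp)
  let F : SimpleGraph V := SimpleGraph.fromRel fun v w =>
    ∃ j, (v = a j ∧ w = b j) ∨ (v = b j ∧ w = a (σ j))
  have hF : ∀ v w, F.Adj v w ↔ v ≠ w ∧
      ((∃ j, (v = a j ∧ w = b j) ∨ (v = b j ∧ w = a (σ j))) ∨
        ∃ j, (w = a j ∧ v = b j) ∨ (w = b j ∧ v = a (σ j))) := fun v w =>
    SimpleGraph.fromRel_adj _ _ _
  have hlne : ∀ j, b j ≠ a (σ j) := fun j => (hlink j).ne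
  refine ⟨F, ?_, ?_, ?_, ?_⟩
  · intro v w h
    rw [hF]
    refine ⟨h.ne, ?_⟩
    obtain ⟨j, ⟨h1, h2⟩ | ⟨h1, h2⟩⟩ := hM v w h
    · exact Or.inl ⟨j, Or.inl ⟨h1, h2⟩⟩
    · exact Or.inr ⟨j, Or.inl ⟨h2, h1⟩⟩
  · intro v w h
    rw [hF] at h
    obtain ⟨hne, ⟨j, ⟨rfl, rfl⟩ | ⟨rfl, rfl⟩⟩ | ⟨j, ⟨rfl, rfl⟩ | ⟨rfl, rfl⟩⟩⟩ := h
    · exact hMH j hne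
    · exact Or.inl (hlink j)
    · exact (hMH j hne.symm).symm
    · exact Or.inl (hlink j).symm
  · intro v
    have hba : ∀ i j, b i = a j → i = j := fun i j h => (hab j i h.symm).symm
    rw [deg, Set.ncard_eq_two]
    obtain ⟨j, rfl | rfl⟩ := hsurj v
    · by_cases hj : a j = b j
      · refine ⟨a (σ j), b (σ.symm j), fun h => hσ3 j (hab _ _ h).symm, ?_⟩
        ext w
        simp only [SimpleGraph.mem_neighborSet, hF, Set.mem_insert_iff, Set.mem_singleton_iff]
        constructor
        · rintro ⟨hne, ⟨i, ⟨h1, rfl⟩ | ⟨h1, rfl⟩⟩ | ⟨i, ⟨rfl, h1⟩ | ⟨rfl, h1⟩⟩⟩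
          · obtain rfl := ha h1
            exact absurd hj hne
          · rw [← hab _ _ h1]
            exact Or.inl rfl
          · rw [← hab _ _ h1] at hne
            exact absurd rfl hne
          · have := ha h1
            right
            rw [this]
            simp
        · rintro (rfl | rfl)
          · exact ⟨fun h => hσ1 j (ha h).symm, Or.inl ⟨j, Or.inr ⟨hj, rfl⟩⟩⟩
          · exact ⟨fun h => hσ2 j (hab _ _ h).symm, Or.inr ⟨σ.symm j, Or.inr ⟨rfl, by simp⟩⟩⟩
      · refine ⟨b j, b (σ.symm j), fun h => hσ2 j (hb h).symm, ?_⟩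
        ext w
        simp only [SimpleGraph.mem_neighborSet, hF, Set.mem_insert_iff, Set.mem_singleton_iff]
        constructor
        · rintro ⟨hne, ⟨i, ⟨h1, rfl⟩ | ⟨h1, rfl⟩⟩ | ⟨i, ⟨rfl, h1⟩ | ⟨rfl, h1⟩⟩⟩
          · rw [ha h1]
            exact Or.inl rfl
          · rw [← hab _ _ h1] at h1
            exact absurd h1 hj
          · rw [← hab _ _ h1] at hne
            exact absurd rfl hne
          · have := ha h1
            right
            rw [this]
            simp
        · rintro (rfl | rfl)
          · exact ⟨hj, Or.inl ⟨j, Or.inl ⟨rfl, rfl⟩⟩⟩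
          · exact ⟨fun h => hσ2 j (hab _ _ h).symm, Or.inr ⟨σ.symm j, Or.inr ⟨rfl, by simp⟩⟩⟩
    · by_cases hj : a j = b j
      · refine ⟨a (σ j), b (σ.symm j), fun h => hσ3 j (hab _ _ h).symm, ?_⟩
        ext w
        simp only [SimpleGraph.mem_neighborSet, hF, Set.mem_insert_iff, Set.mem_singleton_iff]
        constructor
        · rintro ⟨hne, ⟨i, ⟨h1, rfl⟩ | ⟨h1, rfl⟩⟩ | ⟨i, ⟨rfl, h1⟩ | ⟨rfl, h1⟩⟩⟩
          · rw [← hba _ _ h1] at hne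
            exact absurd rfl hne
          · rw [hb h1]
            exact Or.inl rfl
          · rw [← hb h1] at hne
            exact absurd hj.symm hne
          · have := hba _ _ h1
            right
            rw [this]
            simp
        · rintro (rfl | rfl)
          · exact ⟨hlne j, Or.inl ⟨j, Or.inr ⟨rfl, rfl⟩⟩⟩
          · exact ⟨fun h => hσ2 j (hb h).symm, Or.inr ⟨σ.symm j, Or.inr ⟨rfl, by simp [hj]⟩⟩⟩
      · refine ⟨a j, a (σ j), fun h => hσ1 j (ha h).symm, ?_⟩
        ext w
        simp only [SimpleGraph.mem_neighborSet, hF, Set.mem_insert_iff, Set.mem_singleton_iff]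
        constructor
        · rintro ⟨hne, ⟨i, ⟨h1, rfl⟩ | ⟨h1, rfl⟩⟩ | ⟨i, ⟨rfl, h1⟩ | ⟨rfl, h1⟩⟩⟩
          · rw [← hba _ _ h1] at hne
            exact absurd rfl hne
          · rw [hb h1]
            exact Or.inr rfl
          · rw [hb h1]
            exact Or.inl rfl
          · rw [← hba _ _ h1] at h1
            exact absurd h1.symm hj
        · rintro (rfl | rfl)
          · exact ⟨fun h => hj h.symm, Or.inr ⟨j, Or.inl ⟨rfl, rfl⟩⟩⟩
          · exact ⟨hlne j, Or.inl ⟨j, Or.inr ⟨rfl, rfl⟩⟩⟩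
  · have hreach1 : ∀ j, F.Reachable (a j) (b j) := by
      intro j
      by_cases hj : a j = b j
      · rw [hj]
      · exact SimpleGraph.Adj.reachable ((hF _ _).2 ⟨hj, Or.inl ⟨j, Or.inl ⟨rfl, rfl⟩⟩⟩)
    have hreach2 : ∀ j, F.Reachable (a j) (a (σ j)) := fun j =>
      (hreach1 j).trans (SimpleGraph.Adj.reachable
        ((hF _ _).2 ⟨hlne j, Or.inl ⟨j, Or.inr ⟨rfl, rfl⟩⟩⟩))
    have hreach3 : ∀ (m : ℕ) j, F.Reachable (a j) (a ((σ ^ m) j)) := by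
      intro m
      induction m with
      | zero => intro j; simp
      | succ m ih =>
        intro j
        rw [pow_succ']
        exact (ih j).trans (hreach2 _)
    have hcard : J₀.card = Nat.card (J₀ : Set J) := by simp
    rw [numCycles, hcard]
    refine Nat.card_le_card_of_surjective
      (fun j : (J₀ : Set J) => F.connectedComponentMk (a j)) ?_
    intro c
    induction c using SimpleGraph.ConnectedComponent.ind with
    | _ v =>
      obtain ⟨j, hj⟩ := hsurj v
      obtain ⟨m, hm⟩ := hJ₀ j
      refine ⟨⟨_, hm⟩, ?_⟩
      rw [SimpleGraph.ConnectedComponent.eq]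
      rcases hj with rfl | rfl
      · exact (hreach3 m j).symm
      · exact (hreach3 m j).symm.trans (hreach1 j)

/-- A matching `M` extends to a matching of `H ⊔ M`, encoded as an involution, whose
uncovered vertices are independent in `H`. -/
theorem exists_involutive_extending_matching {V : Type} [Fintype V] (H M : SimpleGraph V)
    (hM : ∀ v w w', M.Adj v w → M.Adj v w' → w = w') :
    ∃ μ : V → V, Function.Involutive μ ∧ (∀ v w, M.Adj v w → μ v = w) ∧
      (∀ v, v ≠ μ v → (H ⊔ M).Adj v (μ v)) ∧ ∀ u v, μ u = u → μ v = v → ¬ H.Adj u v := by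
  let P : Set (V → V) := {μ | Function.Involutive μ ∧ (∀ v w, M.Adj v w → μ v = w) ∧
      ∀ v, v ≠ μ v → (H ⊔ M).Adj v (μ v)}
  have hne : P.Nonempty := by
    let μ : V → V := fun v => if h : ∃ w, M.Adj v w then h.choose else v
    have h1 : ∀ v w, M.Adj v w → μ v = w := by
      intro v w h
      have hex : ∃ w, M.Adj v w := ⟨w, h⟩
      simp only [μ, dif_pos hex]
      exact hM v _ _ hex.choose_spec h
    have h2 : ∀ v, (¬ ∃ w, M.Adj v w) → μ v = v := fun v h => by simp only [μ, dif_neg h]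
    refine ⟨μ, fun v => ?_, h1, fun v hv => ?_⟩
    · by_cases h : ∃ w, M.Adj v w
      · obtain ⟨w, hw⟩ := h
        rw [h1 v w hw, h1 w v hw.symm]
      · rw [h2 v h, h2 v h]
    · by_cases h : ∃ w, M.Adj v w
      · obtain ⟨w, hw⟩ := h
        rw [h1 v w hw]
        exact Or.inr hw
      · exact absurd (h2 v h).symm hv
  obtain ⟨μ, hμ, hmin⟩ := Set.exists_min_image P
    (fun μ => (Finset.univ.filter fun v => μ v = v).card) (Set.toFinite _) hne
  refine ⟨μ, hμ.1, hμ.2.1, hμ.2.2, fun u v hu hv huv => ?_⟩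
  obtain ⟨hinv, hext, hadj⟩ := hμ
  let μ' : V → V := fun x => if x = u then v else if x = v then u else μ x
  have hne' : u ≠ v := huv.ne
  have hμu : ∀ x, μ x = u ↔ x = u := fun x =>
    ⟨fun h => by rw [← hinv x, h, hu], fun h => by rw [h, hu]⟩
  have hμv : ∀ x, μ x = v ↔ x = v := fun x =>
    ⟨fun h => by rw [← hinv x, h, hv], fun h => by rw [h, hv]⟩
  have hmem : μ' ∈ P := by
    refine ⟨fun x => ?_, fun x w h => ?_, fun x hx => ?_⟩
    · by_cases hxu : x = u
      · simp [μ', hxu, hne'.symm]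
      · by_cases hxv : x = v
        · simp [μ', hxv]
        · simp [μ', hxu, hxv, hμu, hμv, hinv x]
    · have hw := hext x w h
      have hxu : x ≠ u := fun hx => h.ne (by rw [← hw, hx, hu])
      have hxv : x ≠ v := fun hx => h.ne (by rw [← hw, hx, hv])
      simp [μ', hxu, hxv, hw]
    · by_cases hxu : x = u
      · simp only [μ', hxu, if_true]
        exact Or.inl huv
      · by_cases hxv : x = v
        · simp only [μ', hxv, hne'.symm, if_true, if_false]
          exact Or.inl huv.symm
        · simp only [μ', hxu, hxv, if_false] at hx ⊢
          exact hadj x hx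
  have hlt : (Finset.univ.filter fun v => μ' v = v).card <
      (Finset.univ.filter fun v => μ v = v).card := by
    apply Finset.card_lt_card
    rw [Finset.ssubset_iff_of_subset]
    · exact ⟨u, by simp [hu], by simp [μ', hne'.symm]⟩
    · intro x
      simp only [Finset.mem_filter, Finset.mem_univ, true_and]
      intro hx
      by_cases hxu : x = u
      · rw [hxu, hu]
      · by_cases hxv : x = v
        · rw [hxv, hv]
        · simpa [μ', hxu, hxv] using hx
  exact absurd (hmin μ' hmem) (not_le.2 hlt)

/-- The map `a` picks exactly one element of every orbit of the involution `μ`. -/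
structure IsTransversal {V J : Type} (μ : V → V) (a : J → V) : Prop where
  injective : Function.Injective a
  eq_of_eq : ∀ i j, a i = μ (a j) → i = j
  surjective : ∀ v, ∃ j, v = a j ∨ v = μ (a j)

theorem IsTransversal.swap {V J : Type} {μ : V → V} {a : J → V} (ha : IsTransversal μ a)
    (hμ : Function.Involutive μ) (ρ : Equiv.Perm J) (t : J → Prop) :
    IsTransversal μ fun j => if t j then a (ρ j) else μ (a (ρ j)) := by
  have key : ∀ i j, (a i = a j ∨ a i = μ (a j) ∨ μ (a i) = a j ∨ μ (a i) = μ (a j)) → i = j := by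
    rintro i j (h | h | h | h)
    · exact ha.injective h
    · exact ha.eq_of_eq i j h
    · exact (ha.eq_of_eq j i h.symm).symm
    · exact ha.injective (hμ.injective h)
  refine ⟨fun i j h => ?_, fun i j h => ?_, fun v => ?_⟩
  · apply ρ.injective
    apply key
    split_ifs at h <;> tauto
  · apply ρ.injective
    apply key
    split_ifs at h <;> try rw [hμ] at h
    all_goals tauto
  · obtain ⟨j, hj⟩ := ha.surjective v
    refine ⟨ρ.symm j, ?_⟩
    simp only [Equiv.apply_symm_apply]
    split_ifs
    · exact hj
    · rw [hμ]
      exact hj.symm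

theorem exists_isTransversal {V : Type} [Fintype V] [LinearOrder V] (μ : V → V)
    (hμ : Function.Involutive μ) :
    ∃ A : Finset V, IsTransversal μ ((↑) : A → V) ∧
      2 * A.card = Fintype.card V + (Finset.univ.filter fun v => μ v = v).card := by
  refine ⟨Finset.univ.filter fun v => v ≤ μ v, ⟨Subtype.val_injective, ?_, ?_⟩, ?_⟩
  · rintro ⟨i, hi⟩ ⟨j, hj⟩ h
    simp only [Finset.mem_filter, Finset.mem_univ, true_and] at hi hj h
    subst h
    rw [hμ] at hi
    exact Subtype.ext (le_antisymm hi hj)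
  · intro v
    rcases le_total v (μ v) with h | h
    · exact ⟨⟨v, by simpa using h⟩, Or.inl rfl⟩
    · exact ⟨⟨μ v, by simpa [hμ v] using h⟩, Or.inr (hμ v).symm⟩
  · have h1 : (Finset.univ.filter fun v => v ≤ μ v).card =
        (Finset.univ.filter fun v => μ v ≤ v).card := by
      refine Finset.card_bij (fun v _ => μ v) ?_ (fun v _ w _ h => hμ.injective h) ?_
      · intro v hv
        simpa [hμ v] using hv
      · intro v hv
        exact ⟨μ v, by simpa [hμ v] using hv, hμ v⟩
    have h2 := Finset.card_union_add_card_inter (Finset.univ.filter fun v => v ≤ μ v)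
      (Finset.univ.filter fun v => μ v ≤ v)
    have h3 : (Finset.univ.filter fun v => v ≤ μ v) ∪ (Finset.univ.filter fun v => μ v ≤ v) =
        Finset.univ := by
      ext v
      simp [le_total]
    have h4 : (Finset.univ.filter fun v => v ≤ μ v) ∩ (Finset.univ.filter fun v => μ v ≤ v) =
        Finset.univ.filter fun v => μ v = v := by
      ext v
      simp [le_antisymm_iff, and_comm]
    rw [h3, h4, Finset.card_univ] at h2
    omega

/-- Layered linking: if every vertex has many neighbours among the entries and among the exits of
each layer, the paths can be linked cyclically through the layers, with the `r` leftover paths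
inserted between the layers `0` and `1`. -/
theorem exists_twoFactor_of_layers {V : Type} [Fintype V] {k ℓ r : ℕ} [NeZero ℓ] (hℓ : 3 ≤ ℓ)
    (H M : SimpleGraph V) (μ : V → V) (hμ : Function.Involutive μ)
    (hMμ : ∀ v w, M.Adj v w → μ v = w) (hμH : ∀ v, v ≠ μ v → (H ⊔ M).Adj v (μ v))
    (a : (Fin k × ZMod ℓ) ⊕ Fin r → V) (ha : IsTransversal μ a) (q γ D : ℝ)
    (hq : 0 ≤ q) (hγ : 0 ≤ γ)
    (hDa : ∀ v c, D ≤ ((Finset.univ.filter fun g => H.Adj v (a (Sum.inl (g, c)))).card : ℝ))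
    (hDb : ∀ v c, D ≤ ((Finset.univ.filter fun g => H.Adj v (μ (a (Sum.inl (g, c))))).card : ℝ))
    (hD : q * ((k + r : ℝ) / 2) + 2 * γ < D)
    (hST : ∀ S T : Finset V, (∑ u ∈ S, ∑ v ∈ T, if H.Adj u v then (1 : ℝ) else 0) ≤
      q * S.card * T.card + γ * (S.card + T.card)) :
    ∃ F : SimpleGraph V, M ≤ F ∧ F ≤ H ⊔ M ∧ (∀ v, deg F v = 2) ∧ numCycles F ≤ k := by
  have : Fact (1 < ℓ) := ⟨by omega⟩
  have h2 : (2 : ZMod ℓ) ≠ 0 := by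
    intro h
    have h' : ((2 : ℕ) : ZMod ℓ) = 0 := by exact_mod_cast h
    rw [ZMod.natCast_eq_zero_iff] at h'
    exact absurd (Nat.le_of_dvd (by norm_num) h') (by omega)
  let src : (Fin k × ZMod ℓ) ⊕ Fin r → ZMod ℓ := Sum.elim (fun x => x.2) fun _ => 0
  let tgt : (Fin k × ZMod ℓ) ⊕ Fin r → ZMod ℓ := Sum.elim (fun x => x.2 - 1) fun _ => 0
  let R : (Fin k × ZMod ℓ) ⊕ Fin r → (Fin k × ZMod ℓ) ⊕ Fin r → Prop := fun i j =>
    H.Adj (μ (a i)) (a j) ∧ tgt j = src i ∧ (i.isLeft ∨ j.isLeft)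
  have hbinj : Function.Injective fun j => μ (a j) := hμ.injective.comp ha.injective
  obtain ⟨σ, hσ⟩ : ∃ σ : Equiv.Perm ((Fin k × ZMod ℓ) ⊕ Fin r), ∀ i, R i (σ i) := by
    refine exists_perm_of_fibres src tgt R q γ D (k + r) hq hγ ?_ ?_ (fun i j h => h.2.1)
      ?_ ?_ hD ?_
    · intro c
      refine Finset.card_equiv (Equiv.sumCongr (Equiv.prodCongr (Equiv.refl _)
        (Equiv.addRight (1 : ZMod ℓ))) (Equiv.refl _)) fun j => ?_
      rcases j with ⟨g, x⟩ | z <;> simp [src, tgt]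
    · intro c
      have hsub : (Finset.univ.filter fun j => src j = c) ⊆
          (Finset.univ.image fun g : Fin k => Sum.inl (g, c)) ∪
            Finset.univ.image (Sum.inr : Fin r → (Fin k × ZMod ℓ) ⊕ Fin r) := by
        intro j hj
        rcases j with ⟨g, x⟩ | z
        · simp only [src, Finset.mem_filter, Finset.mem_univ, true_and, Sum.elim_inl] at hj
          simp [hj]
        · simp
      have h3 := (Finset.card_le_card hsub).trans (Finset.card_union_le _ _)
      have h4 := Finset.card_image_le (s := (Finset.univ : Finset (Fin k)))
        (f := fun g : Fin k => (Sum.inl (g, c) : (Fin k × ZMod ℓ) ⊕ Fin r))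
      have h5 := Finset.card_image_le (s := (Finset.univ : Finset (Fin r)))
        (f := (Sum.inr : Fin r → (Fin k × ZMod ℓ) ⊕ Fin r))
      rw [Finset.card_univ, Fintype.card_fin] at h4 h5
      have h6 := h3.trans (add_le_add h4 h5)
      rw [← Nat.cast_add, Nat.cast_le]
      refine le_trans (le_of_eq ?_) h6
      congr!
    · intro i
      simp only [Finset.sum_boole]
      refine (hDa (μ (a i)) (src i + 1)).trans ?_
      norm_cast
      refine Finset.card_le_card_of_injOn (fun g => Sum.inl (g, src i + 1)) ?_ ?_
      · intro g hg
        simpa [R, tgt] using hg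
      · intro g _ g' _ h
        simpa using h
    · intro j
      simp only [Finset.sum_boole]
      refine (hDb (a j) (tgt j)).trans ?_
      norm_cast
      refine Finset.card_le_card_of_injOn (fun g => Sum.inl (g, tgt j)) ?_ ?_
      · intro g hg
        simpa [R, src, H.adj_comm] using hg
      · intro g _ g' _ h
        simpa using h
    · intro S T
      have h3 := hST (S.image fun j => μ (a j)) (T.image a)
      rw [Finset.sum_image hbinj.injOn, Finset.card_image_of_injective _ hbinj,
        Finset.card_image_of_injective _ ha.injective] at h3
      refine le_trans ?_ h3
      refine Finset.sum_le_sum fun i _ => ?_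
      rw [Finset.sum_image ha.injective.injOn]
      refine Finset.sum_le_sum fun j _ => ?_
      by_cases h : H.Adj (μ (a i)) (a j)
      · rw [if_pos h]
        split_ifs <;> norm_num
      · rw [if_neg h, if_neg fun h' => h h'.1]
  have hstep : ∀ g c, c ≠ 0 → ∃ g', σ (Sum.inl (g, c)) = Sum.inl (g', c + 1) := by
    intro g c hc
    have h := (hσ (Sum.inl (g, c))).2.1
    rcases hj : σ (Sum.inl (g, c)) with ⟨g', x⟩ | z
    · rw [hj] at h
      simp only [tgt, src, Sum.elim_inl] at h
      exact ⟨g', by rw [← h]; simp⟩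
    · rw [hj] at h
      simp only [tgt, src, Sum.elim_inl, Sum.elim_inr] at h
      exact absurd h.symm hc
  have hstepz : ∀ z, ∃ g', σ (Sum.inr z) = Sum.inl (g', 1) := by
    intro z
    have h := (hσ (Sum.inr z)).2
    rcases hj : σ (Sum.inr z) with ⟨g', x⟩ | z'
    · rw [hj] at h
      have h' := h.1
      simp only [tgt, src, Sum.elim_inl, Sum.elim_inr] at h'
      exact ⟨g', by rw [sub_eq_zero.1 h']⟩
    · rw [hj] at h
      simp at h
  have hstep0 : ∀ g, (∃ g', σ (Sum.inl (g, 0)) = Sum.inl (g', 1)) ∨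
      ∃ z, σ (Sum.inl (g, 0)) = Sum.inr z := by
    intro g
    have h := (hσ (Sum.inl (g, 0))).2.1
    rcases hj : σ (Sum.inl (g, 0)) with ⟨g', x⟩ | z
    · rw [hj] at h
      simp only [tgt, src, Sum.elim_inl] at h
      exact Or.inl ⟨g', by rw [sub_eq_zero.1 h]⟩
    · exact Or.inr ⟨z, rfl⟩
  have hσσ : ∀ j, σ (σ j) ≠ j := by
    rintro (⟨g, c⟩ | z) h
    · by_cases hc : c = 0
      · subst hc
        rcases hstep0 g with ⟨g', h'⟩ | ⟨z, h'⟩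
        · obtain ⟨g'', h''⟩ := hstep g' 1 one_ne_zero
          rw [h', h''] at h
          simp only [Sum.inl.injEq, Prod.mk.injEq] at h
          exact h2 (by rw [← h.2]; norm_num)
        · obtain ⟨g'', h''⟩ := hstepz z
          rw [h', h''] at h
          simp at h
      · obtain ⟨g', h'⟩ := hstep g c hc
        by_cases hc' : c + 1 = 0
        · rw [h', hc'] at h
          rcases hstep0 g' with ⟨g'', h''⟩ | ⟨z, h''⟩
          · rw [h''] at h
            simp only [Sum.inl.injEq, Prod.mk.injEq] at h
            exact h2 (by rw [← hc', ← h.2]; norm_num)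
          · rw [h''] at h
            simp at h
        · obtain ⟨g'', h''⟩ := hstep g' _ hc'
          rw [h', h''] at h
          simp only [Sum.inl.injEq, Prod.mk.injEq, add_assoc, add_eq_left] at h
          exact h2 (by rw [← h.2]; norm_num)
    · obtain ⟨g', h'⟩ := hstepz z
      obtain ⟨g'', h''⟩ := hstep g' 1 one_ne_zero
      rw [h', h''] at h
      simp at h
  let J₀ : Finset ((Fin k × ZMod ℓ) ⊕ Fin r) := Finset.univ.image fun g => Sum.inl (g, 0)
  have hreach : ∀ (t : ℕ) g (c : ZMod ℓ), c + t = 0 → ∃ m : ℕ, (σ ^ m) (Sum.inl (g, c)) ∈ J₀ := by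
    intro t
    induction t with
    | zero =>
      intro g c hc
      refine ⟨0, ?_⟩
      simp only [Nat.cast_zero, add_zero] at hc
      simp [J₀, hc]
    | succ t ih =>
      intro g c hc
      by_cases hc0 : c = 0
      · exact ⟨0, by simp [J₀, hc0]⟩
      · obtain ⟨g', hg'⟩ := hstep g c hc0
        obtain ⟨m, hm⟩ := ih g' (c + 1) (by rw [← hc]; push_cast; ring)
        refine ⟨m + 1, ?_⟩
        rw [pow_succ, Equiv.Perm.mul_apply, hg']
        exact hm
  have hreach' : ∀ g (c : ZMod ℓ), ∃ m : ℕ, (σ ^ m) (Sum.inl (g, c)) ∈ J₀ := fun g c =>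
    hreach (-c).val g c (by simp)
  obtain ⟨F, h3, h4, h5, h6⟩ := exists_twoFactor_of_perm H M a (fun j => μ (a j)) σ ha.injective
    hbinj ha.eq_of_eq ha.surjective
    (fun v w h => by
      have hw := hMμ v w h
      obtain ⟨j, rfl | rfl⟩ := ha.surjective v
      · exact ⟨j, Or.inl ⟨rfl, hw.symm⟩⟩
      · rw [hμ] at hw
        exact ⟨j, Or.inr ⟨rfl, hw.symm⟩⟩)
    (fun j hj => hμH _ hj) (fun j => (hσ j).1) hσσ J₀
    (by
      rintro (⟨g, c⟩ | z)
      · exact hreach' g c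
      · obtain ⟨g', hg'⟩ := hstepz z
        obtain ⟨m, hm⟩ := hreach' g' 1
        refine ⟨m + 1, ?_⟩
        rw [pow_succ, Equiv.Perm.mul_apply, hg']
        exact hm)
  refine ⟨F, h3, h4, h5, h6.trans ?_⟩
  exact Finset.card_image_le.trans (by simp)

theorem deg_eq_sum {V : Type} [Fintype V] (H : SimpleGraph V) (v : V) :
    (deg H v : ℝ) = ∑ w, if H.Adj v w then (1 : ℝ) else 0 := by
  rw [Finset.sum_boole, deg, ← Set.ncard_coe_finset]
  congr 2
  ext w
  simp

/-- Random cyclic shifts and random orientations of the paths give every vertex many neighbours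
among the entries and among the exits of each layer. -/
theorem exists_balanced_layering {V : Type} [Fintype V] {k ℓ r : ℕ} [NeZero ℓ]
    (H : SimpleGraph V) (μ : V → V) (hμ : Function.Involutive μ)
    (a : (Fin k × ZMod ℓ) ⊕ Fin r → V) (ha : IsTransversal μ a) (δ D : ℝ)
    (hδ : ∀ v, δ ≤ (deg H v : ℝ))
    (h : ((Fintype.card V : ℝ) * (ℓ * 2)) * (2 : ℝ) ^ D *
      Real.exp (-(δ - 2 * r) / (2 * (ℓ * 2))) < 1) :
    ∃ a' : (Fin k × ZMod ℓ) ⊕ Fin r → V, IsTransversal μ a' ∧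
      (∀ v c, D ≤ ((Finset.univ.filter fun g => H.Adj v (a' (Sum.inl (g, c)))).card : ℝ)) ∧
      ∀ v c, D ≤ ((Finset.univ.filter fun g => H.Adj v (μ (a' (Sum.inl (g, c))))).card : ℝ) := by
  let X : V × ZMod ℓ × Bool → Fin k → ZMod ℓ × Bool → Prop := fun e g y =>
    H.Adj e.1 (if y.2 = e.2.2 then a (Sum.inl (g, e.2.1 - y.1))
      else μ (a (Sum.inl (g, e.2.1 - y.1))))
  have hcount : ∀ (v : V), δ - 2 * r ≤ ∑ g, ∑ c,
      ((if H.Adj v (a (Sum.inl (g, c))) then (1 : ℝ) else 0) +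
        if H.Adj v (μ (a (Sum.inl (g, c)))) then 1 else 0) := by
    intro v
    have h1 : (deg H v : ℝ) ≤ ∑ j, ((if H.Adj v (a j) then (1 : ℝ) else 0) +
        if H.Adj v (μ (a j)) then 1 else 0) := by
      rw [Finset.sum_add_distrib, Finset.sum_boole, Finset.sum_boole, deg]
      have h2 : H.neighborSet v ⊆ ((Finset.univ.filter fun j => H.Adj v (a j)).image a ∪
          (Finset.univ.filter fun j => H.Adj v (μ (a j))).image fun j => μ (a j) : Finset V) := by
        intro w hw
        simp only [SimpleGraph.mem_neighborSet] at hw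
        obtain ⟨j, rfl | rfl⟩ := ha.surjective w
        · simp only [Finset.coe_union, Set.mem_union]
          left
          simp only [Finset.coe_image, Set.mem_image]
          exact ⟨j, by simpa using hw, rfl⟩
        · simp only [Finset.coe_union, Set.mem_union]
          right
          simp only [Finset.coe_image, Set.mem_image]
          exact ⟨j, by simpa using hw, rfl⟩
      have h3 := Set.ncard_le_ncard h2
      rw [Set.ncard_coe_finset] at h3
      exact_mod_cast h3.trans ((Finset.card_union_le _ _).trans
        (add_le_add Finset.card_image_le Finset.card_image_le))
    rw [Fintype.sum_sum_type, Fintype.sum_prod_type] at h1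
    have h4 : ∑ z : Fin r, ((if H.Adj v (a (Sum.inr z)) then (1 : ℝ) else 0) +
        if H.Adj v (μ (a (Sum.inr z))) then 1 else 0) ≤ ∑ z : Fin r, (2 : ℝ) := by
      refine Finset.sum_le_sum fun z _ => ?_
      split_ifs <;> norm_num
    rw [Finset.sum_const, Finset.card_univ, Fintype.card_fin, nsmul_eq_mul] at h4
    have := hδ v
    linarith
  obtain ⟨f, hf⟩ := exists_choice_many_hits X (δ - 2 * r) D
    (by
      rintro ⟨v, c, β⟩
      refine (hcount v).trans (le_of_eq (Finset.sum_congr rfl fun g _ => ?_))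
      simp only [X]
      rw [← Finset.sum_boole, Fintype.sum_prod_type,
        ← (Equiv.subLeft c).sum_comp (fun c => ((if H.Adj v (a (Sum.inl (g, c))) then (1 : ℝ) else 0)
          + if H.Adj v (μ (a (Sum.inl (g, c)))) then 1 else 0))]
      refine Finset.sum_congr rfl fun s _ => ?_
      rw [Fintype.sum_bool]
      cases β <;> simp [add_comm])
    (by
      simp only [Fintype.card_prod, ZMod.card, Fintype.card_bool]
      exact_mod_cast h)
  refine ⟨_, ha.swap hμ (Equiv.sumCongr (Equiv.prodShear (Equiv.refl _) fun g =>
    Equiv.subRight (f g).1) (Equiv.refl _)) (Sum.elim (fun x => (f x.1).2 = true) fun _ => True),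
    fun v c => (hf (v, c, true)).le.trans (le_of_eq ?_),
    fun v c => (hf (v, c, false)).le.trans (le_of_eq ?_)⟩
  · congr 2
    ext g
    simp [X]
  · congr 2
    ext g
    simp only [X, Finset.mem_filter, Finset.mem_univ, true_and]
    cases hb : (f g).2 <;> simp [hb, hμ _]

/-- In a dense graph with few edges between small sets, every independent set is small. -/
theorem mul_card_le_of_independent {V : Type} [Fintype V] (H : SimpleGraph V) (δ q γ : ℝ)
    (hδ : ∀ v, δ ≤ (deg H v : ℝ))
    (hST : ∀ S T : Finset V, (∑ u ∈ S, ∑ v ∈ T, if H.Adj u v then (1 : ℝ) else 0) ≤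
      q * S.card * T.card + γ * (S.card + T.card)) (U : Finset V)
    (hU : ∀ u ∈ U, ∀ v ∈ U, ¬ H.Adj u v) :
    δ * U.card ≤ q * U.card * (Fintype.card V - U.card) + γ * Fintype.card V := by
  have h := hST U Uᶜ
  rw [Finset.card_compl, Nat.cast_sub (Finset.card_le_univ U)] at h
  have h1 : δ * U.card ≤ ∑ u ∈ U, ∑ v ∈ Uᶜ, if H.Adj u v then (1 : ℝ) else 0 := by
    calc δ * U.card = ∑ u ∈ U, δ := by simp [mul_comm]
      _ ≤ _ := Finset.sum_le_sum fun u hu => by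
        refine (hδ u).trans (le_of_eq ?_)
        rw [deg_eq_sum]
        symm
        refine Finset.sum_subset (Finset.subset_univ _) fun v _ hv => ?_
        rw [if_neg (hU u hu v (by simpa using hv))]
  have h2 : (U.card : ℝ) + (Fintype.card V - U.card) = Fintype.card V := by ring
  rw [h2] at h
  linarith

set_option maxHeartbeats 1000000 in
/-- A matching extends to a 2-factor with few cycles through a dense graph with few edges between
small sets. -/
theorem exists_twoFactor_of_dense {n : ℕ} (H M : SimpleGraph (Fin n)) (d : ℝ)
    (hL : 10 ^ 10 ≤ Real.log n) (hd : 2 * (Real.log n) ^ 2 ≤ d) (hdn : d ≤ 2 * n)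
    (hdeg : ∀ v, 0.998 * d ≤ (deg H v : ℝ))
    (hST : ∀ S T : Finset (Fin n), (∑ u ∈ S, ∑ v ∈ T, if H.Adj u v then (1 : ℝ) else 0) ≤
      d / n * S.card * T.card + 4 * Real.sqrt d * (S.card + T.card))
    (hM : ∀ v w w', M.Adj v w → M.Adj v w' → w = w') :
    ∃ F : SimpleGraph (Fin n), M ≤ F ∧ F ≤ H ⊔ M ∧ (∀ v, deg F v = 2) ∧
      (numCycles F : ℝ) ≤ 4 * (n : ℝ) * Real.sqrt (Real.log n) / Real.sqrt d := by
  set L := Real.log n with hLdef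
  have hn0 : (0 : ℝ) < n := by
    rcases Nat.eq_zero_or_pos n with h | h
    · exfalso
      rw [hLdef, h] at hL
      norm_num at hL
    · exact_mod_cast h
  have hd0 : 0 < d := by nlinarith
  set s := Real.sqrt d with hs
  have hss : s * s = d := Real.mul_self_sqrt hd0.le
  have hs0 : 0 < s := Real.sqrt_pos.2 hd0
  have hsL : L ≤ s := Real.le_sqrt_of_sq_le (by nlinarith)
  set l := Real.sqrt L with hl
  have hll : l * l = L := Real.mul_self_sqrt (by linarith)
  have hl5 : 10 ^ 5 ≤ l := Real.le_sqrt_of_sq_le (by linarith)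
  have hl0 : 0 < l := by linarith
  obtain ⟨μ, hμ, hMμ, hμH, hμU⟩ := exists_involutive_extending_matching H M hM
  obtain ⟨A, hA, hAcard⟩ := exists_isTransversal μ hμ
  set U := Finset.univ.filter fun v => μ v = v with hUdef
  have hU : (U.card : ℝ) ≤ 0.01 * n := by
    have h1 := mul_card_le_of_independent H (0.998 * d) (d / n) (4 * s) hdeg hST U
      (fun u hu v hv => hμU u v (by simpa [hUdef] using hu) (by simpa [hUdef] using hv))
    rw [Fintype.card_fin] at h1
    by_contra! hcon
    have h2 : d / n * U.card * (n - U.card) ≤ d * U.card * 0.99 := by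
      have h3 : d / n * U.card * (n - U.card) ≤ d / n * U.card * (0.99 * n) := by
        gcongr
        linarith
      refine h3.trans (le_of_eq ?_)
      field_simp
    have h4 : 0.008 * d * U.card ≤ 4 * s * n := by linarith
    have h5 : 0.008 * d * (0.01 * n) ≤ 0.008 * d * U.card := by gcongr
    have h6 : (0.00008 * s) * (s * n) ≤ 4 * (s * n) := by
      rw [← hss] at h4 h5
      linarith
    have h7 := le_of_mul_le_mul_right h6 (by positivity)
    linarith
  set x := s / l / 4 with hx
  have hx3 : 10 ^ 4 ≤ x := by
    rw [hx, le_div_iff₀ (by norm_num), le_div_iff₀ hl0]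
    nlinarith
  set ℓ := ⌈x⌉₊ with hℓdef
  have hxℓ : x ≤ ℓ := Nat.le_ceil x
  have hℓ5 : 10 ^ 5 * (ℓ : ℝ) ≤ s := by
    have h1 : (ℓ : ℝ) < x + 1 := Nat.ceil_lt_add_one (by linarith)
    have h2 : x * (4 * 10 ^ 5) ≤ s := by
      calc x * (4 * 10 ^ 5) ≤ x * (4 * l) := by gcongr
        _ = s := by
          rw [hx]
          field_simp
    linarith
  have hℓ3 : 3 ≤ ℓ := by
    have : (3 : ℝ) ≤ ℓ := by linarith
    exact_mod_cast this
  have hℓ0 : (0 : ℝ) < ℓ := by linarith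
  have : NeZero ℓ := ⟨by omega⟩
  set k := A.card / ℓ with hk
  set r := A.card % ℓ with hr
  have hkr : (k : ℝ) * ℓ + r = A.card := by
    exact_mod_cast Nat.div_add_mod' A.card ℓ
  have hrℓ : (r : ℝ) ≤ ℓ := by
    exact_mod_cast (Nat.mod_lt A.card (by omega)).le
  have hr0 : (0 : ℝ) ≤ r := by positivity
  have hA2 : (2 * A.card : ℝ) ≤ 1.01 * n := by
    have h1 : (2 * A.card : ℝ) = n + U.card := by
      rw [Fintype.card_fin] at hAcard
      exact_mod_cast hAcard
    linarith
  obtain ⟨e⟩ : Nonempty ((Fin k × ZMod ℓ) ⊕ Fin r ≃ A) := by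
    rw [← Fintype.card_eq]
    simp only [Fintype.card_sum, Fintype.card_prod, Fintype.card_fin, ZMod.card,
      Fintype.card_coe]
    exact Nat.div_add_mod' A.card ℓ
  have ha : IsTransversal μ fun j => (e j : Fin n) :=
    ⟨hA.injective.comp e.injective, fun i j h => e.injective (hA.eq_of_eq _ _ h), fun v => by
      obtain ⟨j, hj⟩ := hA.surjective v
      exact ⟨e.symm j, by simpa using hj⟩⟩
  set Q := d / ℓ with hQ
  have hQd : Q * ℓ = d := div_mul_cancel₀ _ hℓ0.ne'
  have hsQ : 10 ^ 5 * s ≤ Q := by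
    rw [hQ, le_div_iff₀ hℓ0, ← hss]
    nlinarith
  obtain ⟨a, ha', hDa, hDb⟩ := exists_balanced_layering H μ hμ _ ha (0.998 * d) (0.27 * Q) hdeg
    (by
      rw [Fintype.card_fin]
      have hn : (n : ℝ) = Real.exp L := (Real.exp_log hn0).symm
      have h1 : (ℓ : ℝ) * 2 ≤ n := by nlinarith
      have h2 : (n : ℝ) * (ℓ * 2) ≤ Real.exp (2 * L) := by
        rw [two_mul, Real.exp_add, ← hn]
        gcongr
      have h3 : (2 : ℝ) ^ (0.27 * Q) = Real.exp (Real.log 2 * (0.27 * Q)) :=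
        Real.rpow_def_of_pos (by norm_num) _
      have h4 : -(0.998 * d - 2 * r) / (2 * (ℓ * 2)) ≤ -0.2495 * Q + 0.5 := by
        rw [div_le_iff₀ (by positivity), ← hQd]
        nlinarith
      calc _ ≤ Real.exp (2 * L) * Real.exp (Real.log 2 * (0.27 * Q)) *
            Real.exp (-0.2495 * Q + 0.5) := by
            rw [h3]
            gcongr
        _ = Real.exp (2 * L + Real.log 2 * (0.27 * Q) + (-0.2495 * Q + 0.5)) := by
            rw [← Real.exp_add, ← Real.exp_add]
        _ < 1 := by
            rw [Real.exp_lt_one_iff]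
            have := Real.log_two_lt_d9
            nlinarith)
  obtain ⟨F, h1, h2, h3, h4⟩ := exists_twoFactor_of_layers hℓ3 H M μ hμ hMμ hμH a ha' (d / n)
    (4 * s) (0.27 * Q) (by positivity) (by positivity) hDa hDb
    (by
      have h5 : d / n * k ≤ 0.505 * Q := by
        rw [div_mul_eq_mul_div, div_le_iff₀ hn0, ← hQd]
        have h6 : (k : ℝ) * ℓ ≤ 0.505 * n := by linarith
        have hQ0 : 0 ≤ Q := by positivity
        nlinarith
      have h6 : d / n * r ≤ 2 * r := by
        gcongr
        rw [div_le_iff₀ hn0]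
        linarith
      linarith)
    hST
  refine ⟨F, h1, h2, h3, ?_⟩
  have h5 : (numCycles F : ℝ) ≤ k := by exact_mod_cast h4
  refine h5.trans ?_
  rw [le_div_iff₀ hs0]
  have h6 : (k : ℝ) * x ≤ n := by
    calc (k : ℝ) * x ≤ k * ℓ := by gcongr
      _ ≤ n := by linarith
  have h7 : x * (4 * l) = s := by
    rw [hx]
    field_simp
  rw [← h7]
  nlinarith

/-- Greedy proper edge colouring in which every colour is used on at most `b` bad edges. -/
theorem exists_proper_edge_colouring {V : Type} [Fintype V] (H : SimpleGraph V) (r b c : ℕ)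
    (hdeg : ∀ v, deg H v = r) (B : Set (Sym2 V)) (hc : 2 * r * b + B.ncard < c * b) :
    ∃ col : Sym2 V → Fin c,
      (∀ e ∈ H.edgeSet, ∀ f ∈ H.edgeSet, ∀ v ∈ e, v ∈ f → col e = col f → e = f) ∧
      ∀ i, {e | e ∈ H.edgeSet ∧ e ∈ B ∧ col e = i}.ncard ≤ b := by
  have hc0 : 0 < c := Nat.pos_of_ne_zero fun h => by simp [h] at hc
  have : Inhabited (Fin c) := ⟨⟨0, hc0⟩⟩
  have hinc : ∀ x : V, (H.incidenceFinset x).card = r := by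
    intro x
    rw [SimpleGraph.card_incidenceFinset_eq_degree, ← hdeg x, deg,
      ← SimpleGraph.card_neighborFinset_eq_degree, ← Set.ncard_coe_finset,
      SimpleGraph.coe_neighborFinset]
  have key : ∀ E : Finset (Sym2 V), E ⊆ H.edgeFinset → ∃ col : Sym2 V → Fin c,
      (∀ e ∈ E, ∀ f ∈ E, ∀ v ∈ e, v ∈ f → col e = col f → e = f) ∧
      ∀ i, (E.filter fun e => e ∈ B ∧ col e = i).card ≤ b := by
    intro E
    induction E using Finset.induction_on with
    | empty => exact fun _ => ⟨fun _ => default, by simp, by simp⟩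
    | insert e E he ih =>
      intro hE
      obtain ⟨col, hcol, hbad⟩ := ih ((Finset.subset_insert e E).trans hE)
      set adj : Finset (Fin c) := (E.filter fun f => ∃ v ∈ e, v ∈ f).image col
      set full : Finset (Fin c) :=
        Finset.univ.filter fun i => b ≤ (E.filter fun e => e ∈ B ∧ col e = i).card
      have hadj : adj.card ≤ 2 * r := by
        refine Finset.card_image_le.trans ?_
        induction e with
        | _ x y =>
          have hsub : (E.filter fun f => ∃ v ∈ s(x, y), v ∈ f) ⊆
              H.incidenceFinset x ∪ H.incidenceFinset y := by
            intro f hf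
            rw [Finset.mem_filter] at hf
            obtain ⟨hfE, v, hv, hvf⟩ := hf
            have hfH : f ∈ H.edgeSet := by
              rw [← SimpleGraph.mem_edgeFinset]
              exact hE (Finset.mem_insert_of_mem hfE)
            rw [Finset.mem_union, SimpleGraph.mem_incidenceFinset,
              SimpleGraph.mem_incidenceFinset]
            rcases Sym2.mem_iff.1 hv with rfl | rfl
            · exact Or.inl ⟨hfH, hvf⟩
            · exact Or.inr ⟨hfH, hvf⟩
          refine (Finset.card_le_card hsub).trans ((Finset.card_union_le _ _).trans ?_)
          rw [hinc, hinc, two_mul]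
      have hfull : full.card * b ≤ B.ncard := by
        calc full.card * b = ∑ i ∈ full, b := by simp
          _ ≤ ∑ i ∈ full, (E.filter fun e => e ∈ B ∧ col e = i).card :=
            Finset.sum_le_sum fun i hi => (Finset.mem_filter.1 hi).2
          _ ≤ ∑ i, (E.filter fun e => e ∈ B ∧ col e = i).card :=
            Finset.sum_le_sum_of_subset (Finset.subset_univ _)
          _ = (E.filter fun e => e ∈ B).card := by
            rw [Finset.card_eq_sum_card_fiberwise (f := col) (t := Finset.univ) (by simp)]
            simp only [Finset.filter_filter]
          _ ≤ B.ncard := by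
            rw [← Set.ncard_coe_finset]
            refine Set.ncard_le_ncard (fun x hx => ?_) (Set.toFinite _)
            simpa using (Finset.mem_filter.1 hx).2
      have hlt : (adj ∪ full).card < c := by
        refine (Finset.card_union_le _ _).trans_lt ?_
        refine lt_of_mul_lt_mul_right ?_ (Nat.zero_le b)
        nlinarith
      obtain ⟨i, hi⟩ : ∃ i, i ∉ adj ∪ full := by
        by_contra! hall
        rw [Finset.eq_univ_of_forall hall, Finset.card_univ, Fintype.card_fin] at hlt
        exact lt_irrefl _ hlt
      rw [Finset.mem_union, not_or] at hi
      have hiadj : ∀ f ∈ E, ∀ v ∈ e, v ∈ f → col f ≠ i := fun f hf v hve hvf h =>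
        hi.1 (Finset.mem_image.2 ⟨f, Finset.mem_filter.2 ⟨hf, v, hve, hvf⟩, h⟩)
      have hifull : (E.filter fun e => e ∈ B ∧ col e = i).card < b := by
        by_contra! h
        exact hi.2 (Finset.mem_filter.2 ⟨Finset.mem_univ _, h⟩)
      have hupd : ∀ f ∈ E, Function.update col e i f = col f := fun f hf =>
        Function.update_of_ne (fun h : f = e => he (by rw [← h]; exact hf)) _ _
      refine ⟨Function.update col e i, ?_, fun j => ?_⟩
      · intro f hf g hg v hvf hvg hfg
        rcases Finset.mem_insert.1 hf with rfl | hf' <;> rcases Finset.mem_insert.1 hg with rfl | hg'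
        · rfl
        · rw [Function.update_self, hupd g hg'] at hfg
          exact absurd hfg.symm (hiadj g hg' v hvf hvg)
        · rw [Function.update_self, hupd f hf'] at hfg
          exact absurd hfg (hiadj f hf' v hvg hvf)
        · rw [hupd f hf', hupd g hg'] at hfg
          exact hcol f hf' g hg' v hvf hvg hfg
      · have hE' : (E.filter fun f => f ∈ B ∧ Function.update col e i f = j) =
            E.filter fun f => f ∈ B ∧ col f = j :=
          Finset.filter_congr fun f hf => by rw [hupd f hf]
        rw [Finset.filter_insert, Function.update_self, hE']
        split_ifs with h
        · rw [← h.2]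
          exact (Finset.card_insert_le _ _).trans hifull
        · exact hbad j
  obtain ⟨col, h1, h2⟩ := key H.edgeFinset subset_rfl
  refine ⟨col, fun e he f hf => h1 e (by simpa using he) f (by simpa using hf), fun i => ?_⟩
  refine le_trans (le_of_eq ?_) (h2 i)
  rw [← Set.ncard_coe_finset]
  congr 1
  ext e
  simp

/-- Greedy choice of pairwise disjoint 2-factors containing prescribed disjoint graphs. -/
theorem exists_disjoint_twoFactors {V : Type} [Fintype V] (H : SimpleGraph V)
    (M : ℕ → SimpleGraph V) (P : SimpleGraph V → Prop) (T : ℕ) (hHM : ∀ i, Disjoint H (M i))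
    (hMM : ∀ i j, i ≠ j → Disjoint (M i) (M j))
    (hstep : ∀ K ≤ H, ∀ i, (∀ v, (deg H v : ℝ) ≤ deg K v + 2 * T) →
      ∃ F, M i ≤ F ∧ F ≤ K ⊔ M i ∧ (∀ v, deg F v = 2) ∧ P F) :
    ∃ F : ℕ → SimpleGraph V, (∀ i < T, M i ≤ F i ∧ F i ≤ H ⊔ M i ∧ (∀ v, deg (F i) v = 2) ∧
      P (F i)) ∧ ∀ i < T, ∀ j < T, i ≠ j → Disjoint (F i) (F j) := by
  have key : ∀ t ≤ T, ∃ F : ℕ → SimpleGraph V,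
      (∀ i < t, M i ≤ F i ∧ F i ≤ H ⊔ M i ∧ (∀ v, deg (F i) v = 2) ∧ P (F i)) ∧
      ∀ i < t, ∀ j < t, i ≠ j → Disjoint (F i) (F j) := by
    intro t
    induction t with
    | zero => exact fun _ => ⟨fun _ => ⊥, by simp, by simp⟩
    | succ t ih =>
      intro ht
      obtain ⟨F, hF, hFd⟩ := ih (by omega)
      set K := H \ ⨆ j : Fin t, F j with hK
      obtain ⟨F', h1, h2, h3, h4⟩ := hstep K sdiff_le t (by
        intro v
        have hle : (deg H v : ℝ) ≤ deg K v + ∑ j : Fin t, (deg (F j) v : ℝ) := by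
          simp only [deg_eq_sum]
          rw [Finset.sum_comm, ← Finset.sum_add_distrib]
          refine Finset.sum_le_sum fun w _ => ?_
          have hnn : ∀ j : Fin t, (0 : ℝ) ≤ if (F j).Adj v w then (1 : ℝ) else 0 := fun j => by
            split_ifs <;> norm_num
          have hnn' := Finset.sum_nonneg (s := Finset.univ) fun j _ => hnn j
          by_cases hH : H.Adj v w
          · by_cases hj : ∃ j : Fin t, (F j).Adj v w
            · obtain ⟨j, hj⟩ := hj
              have h5 := Finset.single_le_sum (fun j _ => hnn j) (Finset.mem_univ j)
              rw [if_pos hj] at h5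
              rw [if_pos hH]
              split_ifs <;> linarith
            · have hKa : K.Adj v w := by
                rw [hK, SimpleGraph.sdiff_adj, SimpleGraph.iSup_adj]
                exact ⟨hH, hj⟩
              rw [if_pos hH, if_pos hKa]
              linarith
          · rw [if_neg hH]
            split_ifs <;> linarith
        have hsum : ∑ j : Fin t, (deg (F j) v : ℝ) = t * 2 := by
          rw [Finset.sum_congr rfl fun j _ => by rw [(hF j j.2).2.2.1 v]]
          simp
        have htT : (t : ℝ) ≤ T := by exact_mod_cast (by omega : t ≤ T)
        linarith)
      have hnew : ∀ j < t, Disjoint F' (F j) := by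
        intro j hj
        refine Disjoint.mono_left h2 (disjoint_sup_left.2 ⟨?_, ?_⟩)
        · exact Disjoint.mono_right (le_iSup (fun j : Fin t => F j) ⟨j, hj⟩) disjoint_sdiff_self_left
        · exact Disjoint.mono_right (hF j hj).2.1
            (disjoint_sup_right.2 ⟨(hHM t).symm, hMM t j (by omega)⟩)
      have hold : ∀ j < t, Function.update F t F' j = F j := fun j hj =>
        Function.update_of_ne (by omega) _ _
      refine ⟨Function.update F t F', fun i hi => ?_, fun i hi j hj hij => ?_⟩
      · rcases Nat.lt_succ_iff_lt_or_eq.1 hi with hi' | rfl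
        · rw [hold i hi']
          exact hF i hi'
        · rw [Function.update_self]
          exact ⟨h1, h2.trans (sup_le_sup_right sdiff_le _), h3, h4⟩
      · rcases Nat.lt_succ_iff_lt_or_eq.1 hi with hi' | rfl <;>
          rcases Nat.lt_succ_iff_lt_or_eq.1 hj with hj' | rfl
        · rw [hold i hi', hold j hj']
          exact hFd i hi' j hj' hij
        · rw [hold i hi', Function.update_self]
          exact (hnew i hi').symm
        · rw [hold j hj', Function.update_self]
          exact hnew j hj'
        · exact absurd rfl hij
  exact key T le_rfl

end EDHC

open EDHC in
/-- Lemma 6.8 (PMatchSplit). -/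
theorem stmt_17 :
    ∃ N : ℕ, ∀ n : ℕ, N ≤ n →
      ∀ (rG : ℝ) (G H H' : SimpleGraph (Fin n)) (rH' : ℕ) (Ebad : Set (Sym2 (Fin n))),
      IsPseudorandom n G (rG / n) → 2 * (Real.log n) ^ 2 ≤ rG →
      H ≤ G → (1 - 1 / 1100) * rG ≤ (minDeg H : ℝ) →
      (∀ v, deg H' v = rH') → Disjoint H.edgeSet H'.edgeSet →
      Ebad ⊆ H'.edgeSet →
      (rH' : ℝ) + 1 + 10 ^ 6 * (Ebad.ncard : ℝ) / n ≤ rG / 5000 →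
      ∃ (m : ℕ) (F : Fin (2 * m) → SimpleGraph (Fin n)),
        (m : ℝ) ≤ rG / 5000 ∧
        (∀ i, F i ≤ H ⊔ H' ∧ ∀ v, deg (F i) v = 2) ∧
        (∀ i j, i ≠ j → Disjoint (F i).edgeSet (F j).edgeSet) ∧
        H'.edgeSet ⊆ (⋃ i, (F i).edgeSet) ∧
        (∀ i, (numCycles (F i) : ℝ) ≤ 4 * (n : ℝ) * Real.sqrt (Real.log n) / Real.sqrt rG) ∧
        (∀ i, IsMatchingSet ((F i).edgeSet ∩ Ebad) ∧
          ((((F i).edgeSet ∩ Ebad).ncard : ℝ)) ≤ (n : ℝ) / 10 ^ 6) := by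
  obtain ⟨N, hN⟩ := Filter.eventually_atTop.1 ((Filter.tendsto_atTop.1
    (Real.tendsto_log_atTop.comp tendsto_natCast_atTop_atTop)) (10 ^ 10 : ℝ))
  refine ⟨max N (10 ^ 6), ?_⟩
  intro n hn rG G H H' rH' Ebad hG hrG hHG hHmin hH'deg hdisj hbad hsize
  have hL : 10 ^ 10 ≤ Real.log n := hN n ((le_max_left _ _).trans hn)
  have hn6 : 10 ^ 6 ≤ n := (le_max_right _ _).trans hn
  have hn0 : (0 : ℝ) < n := by exact_mod_cast (by omega : 0 < n)
  have hrG0 : 0 < rG := by nlinarith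
  have hHdeg : ∀ v, (1 - 1 / 1100) * rG ≤ (deg H v : ℝ) := by
    intro v
    have h : minDeg H ≤ deg H v := Nat.sInf_le ⟨v, rfl⟩
    exact hHmin.trans (Nat.cast_le.2 h)
  have hrGn : rG ≤ 2 * n := by
    have h1 := hHdeg ⟨0, by omega⟩
    have h2 : (deg H ⟨0, by omega⟩ : ℝ) ≤ n := by
      rw [deg_eq_sum]
      calc _ ≤ ∑ w : Fin n, (1 : ℝ) := Finset.sum_le_sum fun w _ => by split_ifs <;> norm_num
        _ = n := by simp
    linarith
  set b := n / 10 ^ 6 with hb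
  set m := ⌊rG / 5000⌋₊ with hm
  have hmle : (m : ℝ) ≤ rG / 5000 := Nat.floor_le (by positivity)
  have hmlt : rG / 5000 < m + 1 := Nat.lt_floor_add_one _
  have hbn : (b : ℝ) ≤ n / 10 ^ 6 := by
    rw [hb]
    exact_mod_cast Nat.cast_div_le (α := ℝ) (m := n) (n := 10 ^ 6)
  have hnb : (n : ℝ) ≤ 2 * 10 ^ 6 * b := by
    have : n ≤ 2 * 10 ^ 6 * b := by omega
    exact_mod_cast this
  have hb0 : (0 : ℝ) < b := by
    have : 0 < b := by omega
    exact_mod_cast this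
  obtain ⟨col, hcol, hcolbad⟩ := exists_proper_edge_colouring H' rH' b (2 * m) hH'deg Ebad (by
    have h1 : (rH' : ℝ) + 10 ^ 6 * (Ebad.ncard : ℝ) / n < m := by linarith
    have h2 : (Ebad.ncard : ℝ) ≤ 2 * b * (10 ^ 6 * (Ebad.ncard : ℝ) / n) := by
      rw [← mul_div_assoc, le_div_iff₀ hn0]
      have h3 : (0 : ℝ) ≤ Ebad.ncard := by positivity
      nlinarith
    have h3 : (2 * rH' * b + Ebad.ncard : ℝ) < 2 * m * b := by nlinarith
    exact_mod_cast h3)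
  let M : ℕ → SimpleGraph (Fin n) := fun i =>
    { Adj := fun v w => H'.Adj v w ∧ (col s(v, w) : ℕ) = i
      symm := ⟨fun v w h => ⟨h.1.symm, by rw [Sym2.eq_swap]; exact h.2⟩⟩
      loopless := ⟨fun v h => H'.loopless.irrefl v h.1⟩ }
  have hMH' : ∀ i, M i ≤ H' := fun i v w h => h.1
  have hMmatch : ∀ i v w w', (M i).Adj v w → (M i).Adj v w' → w = w' := by
    intro i v w w' h h'
    have := hcol s(v, w) h.1 s(v, w') h'.1 v (Sym2.mem_mk_left v w) (Sym2.mem_mk_left v w')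
      (Fin.ext (h.2.trans h'.2.symm))
    exact Sym2.congr_right.1 this
  have hHH' : Disjoint H H' := SimpleGraph.disjoint_edgeSet.1 hdisj
  obtain ⟨F, hF, hFd⟩ := exists_disjoint_twoFactors H M
    (fun F => (numCycles F : ℝ) ≤ 4 * (n : ℝ) * Real.sqrt (Real.log n) / Real.sqrt rG) (2 * m)
    (fun i => hHH'.mono_right (hMH' i))
    (fun i j hij => by
      rw [← SimpleGraph.disjoint_edgeSet, Set.disjoint_left]
      intro e
      induction e with
      | _ x y => exact fun h1 h2 => hij (h1.2.symm.trans h2.2))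
    (by
      intro K hK i hKdeg
      refine exists_twoFactor_of_dense K (M i) rG hL hrG hrGn (fun v => ?_) (fun S T => ?_)
        (hMmatch i)
      · have h1 := hHdeg v
        have h2 := hKdeg v
        push_cast at h2
        linarith
      · have hp : 0 ≤ rG / n := by positivity
        have h1 := sum_adj_le_of_isJumbled G _ _ hp (by positivity) hG.1 S T
        have hsqrt : Real.sqrt (n * (rG / n) * (1 - rG / n)) ≤ Real.sqrt rG := by
          apply Real.sqrt_le_sqrt
          rw [mul_div_cancel₀ _ hn0.ne']
          nlinarith
        have h2 : (∑ u ∈ S, ∑ v ∈ T, if K.Adj u v then (1 : ℝ) else 0) ≤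
            ∑ u ∈ S, ∑ v ∈ T, if G.Adj u v then (1 : ℝ) else 0 := by
          refine Finset.sum_le_sum fun u _ => Finset.sum_le_sum fun v _ => ?_
          by_cases h : K.Adj u v
          · rw [if_pos h, if_pos (hHG (hK h))]
          · rw [if_neg h]
            split_ifs <;> norm_num
        refine h2.trans (h1.trans ?_)
        have h3 : (0 : ℝ) ≤ (S.card : ℝ) + T.card := by positivity
        nlinarith [mul_le_mul_of_nonneg_right hsqrt h3])
  have hFM : ∀ i < 2 * m, (F i).edgeSet ∩ Ebad ⊆
      {e | e ∈ H'.edgeSet ∧ e ∈ Ebad ∧ (col e : ℕ) = i} := by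
    rintro i hi e ⟨heF, heB⟩
    refine ⟨hbad heB, heB, ?_⟩
    have hle := (hF i hi).2.1
    have heH' := hbad heB
    induction e with
    | _ x y =>
      rcases hle heF with h | h
      · exact absurd heH' (Set.disjoint_left.1 hdisj h)
      · exact h.2
  refine ⟨m, fun i => F i, hmle, fun i => ⟨?_, (hF i i.2).2.2.1⟩, fun i j hij => ?_, ?_,
    fun i => (hF i i.2).2.2.2, fun i => ⟨?_, ?_⟩⟩
  · exact (hF i i.2).2.1.trans (sup_le_sup_left (hMH' i) _)
  · exact SimpleGraph.disjoint_edgeSet.2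
      (hFd i i.2 j j.2 fun h => hij (Fin.ext h))
  · intro e he
    refine Set.mem_iUnion.2 ⟨col e, ?_⟩
    have hle := (hF (col e) (col e).2).1
    induction e with
    | _ x y => exact hle ⟨he, rfl⟩
  · intro e he f hf hef v hve hvf
    have he' := hFM i i.2 he
    have hf' := hFM i i.2 hf
    exact hef (hcol e he'.1 f hf'.1 v hve hvf (Fin.ext (he'.2.2.trans hf'.2.2.symm)))
  · refine le_trans ?_ hbn
    have h1 := Set.ncard_le_ncard (hFM i i.2) (Set.toFinite _)
    refine Nat.cast_le.2 (h1.trans (le_trans (le_of_eq ?_) (hcolbad i)))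
    simp only [Fin.ext_iff]
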